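/- Fix a₁ < a₂ in ℕ and set s₀ := s({a₁, a₂}). There exists a constant C > 0, depending only on a₁ and a₂, such that for every integer n ≥ a₂ and all A, B ⊆ ℕ with {a₁, a₂} ⊆ A, {a₁, a₂} ⊆ B, and A ∩ {1, ..., n} = B ∩ {1, ..., n}, one has |Φ(A) − Φ(B)| ≤ C·2^{-s₀·n²}. -/

import Mathlib

/-- The Moran sum `Σ_{a ∈ F} 2^{-a²·s}` for a finite set `F ⊆ ℕ`. -/
noncomputable def moranSumSq (F : Finset ℕ) (s : ℝ) : ℝ :=
  ∑ a ∈ F, (2 : ℝ) ^ (-((a : ℝ) ^ 2) * s)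

/-- `Φ(A) = sup{ s(F) : F ⊆ A finite, #F ≥ 2 }` (with `sup ∅ = 0`, which is Lean's
convention for `sSup` of the empty set of reals), where `s(F)` is the unique positive
root of `Σ_{a∈F} 2^{-a²·s} = 1`. -/
noncomputable def phiSq (A : Set ℕ) : ℝ :=
  sSup {s : ℝ | 0 < s ∧ ∃ F : Finset ℕ, ↑F ⊆ A ∧ 2 ≤ F.card ∧ moranSumSq F s = 1}

theorem continuous_moranSumSq (F : Finset ℕ) : Continuous (moranSumSq F) := by
  unfold moranSumSq
  refine continuous_finsetSum _ fun a _ => ?_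
  exact Continuous.rpow continuous_const (by fun_prop) fun x => Or.inl (by norm_num)

theorem moran_term_anti (a : ℕ) {s t : ℝ} (h : s ≤ t) :
    (2 : ℝ) ^ (-((a : ℝ) ^ 2) * t) ≤ (2 : ℝ) ^ (-((a : ℝ) ^ 2) * s) := by
  apply Real.rpow_le_rpow_of_exponent_le (by norm_num)
  nlinarith [sq_nonneg (a : ℝ)]

theorem moranSumSq_anti (F : Finset ℕ) {s t : ℝ} (h : s ≤ t) :
    moranSumSq F t ≤ moranSumSq F s :=
  Finset.sum_le_sum fun a _ => moran_term_anti a h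

theorem moranSumSq_mono {F G : Finset ℕ} (h : F ⊆ G) (s : ℝ) :
    moranSumSq F s ≤ moranSumSq G s :=
  Finset.sum_le_sum_of_subset_of_nonneg h fun _ _ _ => by positivity

/-- Lower bound for the decrease of the Moran sum, from the single index `b`. -/
theorem le_moranSumSq_sub {F : Finset ℕ} {b : ℕ} (hb : b ∈ F) {s t : ℝ} (h : t ≤ s) :
    (s - t) * ((b : ℝ) ^ 2 * Real.log 2 * (2 : ℝ) ^ (-((b : ℝ) ^ 2) * s)) ≤
      moranSumSq F t - moranSumSq F s := by
  have h1 : (2 : ℝ) ^ (-((b : ℝ) ^ 2) * t) - (2 : ℝ) ^ (-((b : ℝ) ^ 2) * s) ≤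
      moranSumSq F t - moranSumSq F s := by
    unfold moranSumSq
    rw [← Finset.sum_sub_distrib]
    exact Finset.single_le_sum
      (f := fun a : ℕ => (2 : ℝ) ^ (-((a : ℝ) ^ 2) * t) - (2 : ℝ) ^ (-((a : ℝ) ^ 2) * s))
      (fun a _ => sub_nonneg.2 (moran_term_anti a h)) hb
  refine le_trans ?_ h1
  have h2 : (2 : ℝ) ^ (-((b : ℝ) ^ 2) * t) =
      (2 : ℝ) ^ (-((b : ℝ) ^ 2) * s) * (2 : ℝ) ^ ((b : ℝ) ^ 2 * (s - t)) := by
    rw [← Real.rpow_add (by norm_num)]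
    ring_nf
  have h3 : Real.log 2 * ((b : ℝ) ^ 2 * (s - t)) + 1 ≤ (2 : ℝ) ^ ((b : ℝ) ^ 2 * (s - t)) := by
    rw [Real.rpow_def_of_pos (by norm_num)]
    exact Real.add_one_le_exp _
  have h4 : (0 : ℝ) < (2 : ℝ) ^ (-((b : ℝ) ^ 2) * s) := by positivity
  rw [h2]
  nlinarith [mul_le_mul_of_nonneg_left h3 h4.le]

/-- Geometric bound for the Moran sum over indices larger than `n`. -/
theorem moranSumSq_tail_le {F : Finset ℕ} {n : ℕ} (hF : ∀ a ∈ F, n < a) {s : ℝ} (hs : 0 < s) :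
    moranSumSq F s ≤
      (2 : ℝ) ^ (-s * (n : ℝ) ^ 2) * ((2 : ℝ) ^ (-s) * (1 - (2 : ℝ) ^ (-s))⁻¹) := by
  set q : ℝ := (2 : ℝ) ^ (-s) with hq
  have hq0 : 0 ≤ q := by positivity
  have hq1 : q < 1 := Real.rpow_lt_one_of_one_lt_of_neg (by norm_num) (by linarith)
  have hterm : ∀ a ∈ F, (2 : ℝ) ^ (-((a : ℝ) ^ 2) * s) ≤
      (2 : ℝ) ^ (-s * (n : ℝ) ^ 2) * (q * q ^ (a - (n + 1))) := by
    intro a ha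
    obtain ⟨k, rfl⟩ := Nat.exists_eq_add_of_le (Nat.succ_le_of_lt (hF a ha))
    have hk : n.succ + k - (n + 1) = k := by omega
    rw [hk, ← Real.rpow_natCast q, hq, ← Real.rpow_mul (by norm_num),
      ← Real.rpow_add (by norm_num), ← Real.rpow_add (by norm_num)]
    apply Real.rpow_le_rpow_of_exponent_le (by norm_num)
    have hsq : (n : ℝ) ^ 2 + 1 + k ≤ ((n.succ + k : ℕ) : ℝ) ^ 2 := by
      have : n ^ 2 + 1 + k ≤ (n.succ + k) ^ 2 := by
        rw [Nat.succ_eq_add_one]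
        nlinarith [Nat.zero_le (n * k), Nat.zero_le (k ^ 2)]
      exact_mod_cast this
    nlinarith
  have hinj : Set.InjOn (fun a : ℕ => a - (n + 1)) F := by
    intro a ha b hb hab
    have h1 := hF a ha
    have h2 := hF b hb
    simp only at hab
    omega
  calc moranSumSq F s
      ≤ ∑ a ∈ F, (2 : ℝ) ^ (-s * (n : ℝ) ^ 2) * (q * q ^ (a - (n + 1))) :=
        Finset.sum_le_sum hterm
    _ = (2 : ℝ) ^ (-s * (n : ℝ) ^ 2) * (q * ∑ k ∈ F.image fun a => a - (n + 1), q ^ k) := by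
        rw [Finset.sum_image hinj, Finset.mul_sum, Finset.mul_sum]
    _ ≤ (2 : ℝ) ^ (-s * (n : ℝ) ^ 2) * (q * (1 - q)⁻¹) := by
        gcongr
        rw [← tsum_geometric_of_lt_one hq0 hq1]
        exact (summable_geometric_of_lt_one hq0 hq1).sum_le_tsum _ fun _ _ => by positivity

theorem moranSumSq_one_le {F : Finset ℕ} (hF : ∀ a ∈ F, 1 ≤ a) : moranSumSq F 1 ≤ 1 := by
  refine (moranSumSq_tail_le (n := 0) hF one_pos).trans_eq ?_
  rw [Real.rpow_neg_one]
  norm_num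

theorem le_one_of_moranSumSq_eq_one {F : Finset ℕ} (hF : ∀ a ∈ F, 1 ≤ a) {s : ℝ}
    (h : moranSumSq F s = 1) : s ≤ 1 := by
  by_contra! hs
  obtain ⟨b, hb⟩ : F.Nonempty := by
    rw [Finset.nonempty_iff_ne_empty]
    rintro rfl
    simp [moranSumSq] at h
  have h1 := le_moranSumSq_sub hb hs.le
  have hb1 : (0 : ℝ) < b := by exact_mod_cast hF b hb
  have : 0 < (s - 1) * ((b : ℝ) ^ 2 * Real.log 2 * (2 : ℝ) ^ (-((b : ℝ) ^ 2) * s)) :=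
    mul_pos (by linarith) (by have := Real.log_pos one_lt_two; positivity)
  linarith [moranSumSq_one_le hF]

theorem le_phiSq {A : Set ℕ} (hA : ∀ a ∈ A, 1 ≤ a) {F : Finset ℕ} (hFA : ↑F ⊆ A)
    (hF : 2 ≤ F.card) {s : ℝ} (hs : 0 < s) (h : moranSumSq F s = 1) : s ≤ phiSq A := by
  refine le_csSup ⟨1, ?_⟩ ⟨hs, F, hFA, hF, h⟩
  rintro t ⟨-, G, hG, -, ht⟩
  exact le_one_of_moranSumSq_eq_one (fun a ha => hA a (hG ha)) ht

/-- One-sided comparison of `phiSq` for sets agreeing up to `n`. -/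
theorem phiSq_le_add {a₁ a₂ : ℕ} (ha₁ : 1 ≤ a₁) (ha : a₁ < a₂) {s₀ : ℝ} (hs₀ : 0 < s₀)
    (hs₀eq : moranSumSq ({a₁, a₂} : Finset ℕ) s₀ = 1) {n : ℕ} {A B : Set ℕ}
    (hA : ∀ a ∈ A, 1 ≤ a) (hB : ∀ a ∈ B, 1 ≤ a) (h₁A : a₁ ∈ A) (h₂A : a₂ ∈ A)
    (h₁B : a₁ ∈ B) (h₂B : a₂ ∈ B) (hAB : ∀ k : ℕ, 1 ≤ k → k ≤ n → k ∈ A → k ∈ B) :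
    phiSq A ≤ phiSq B + (2 : ℝ) ^ (-s₀) * (1 - (2 : ℝ) ^ (-s₀))⁻¹ /
      ((a₁ : ℝ) ^ 2 * Real.log 2 * (2 : ℝ) ^ (-((a₁ : ℝ) ^ 2))) *
        (2 : ℝ) ^ (-s₀ * (n : ℝ) ^ 2) := by
  have hq1 : (2 : ℝ) ^ (-s₀) < 1 :=
    Real.rpow_lt_one_of_one_lt_of_neg (by norm_num) (by linarith)
  have ha₁' : (0 : ℝ) < a₁ := by exact_mod_cast ha₁
  have hlog := Real.log_pos one_lt_two
  have hD : 0 < (a₁ : ℝ) ^ 2 * Real.log 2 * (2 : ℝ) ^ (-((a₁ : ℝ) ^ 2)) := by positivity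
  set D := (a₁ : ℝ) ^ 2 * Real.log 2 * (2 : ℝ) ^ (-((a₁ : ℝ) ^ 2)) with hDdef
  have hE : 0 < (2 : ℝ) ^ (-s₀) * (1 - (2 : ℝ) ^ (-s₀))⁻¹ :=
    mul_pos (by positivity) (inv_pos.2 (by linarith))
  set E := (2 : ℝ) ^ (-s₀) * (1 - (2 : ℝ) ^ (-s₀))⁻¹
  have hpair : 2 ≤ ({a₁, a₂} : Finset ℕ).card := (Finset.card_pair ha.ne).ge
  have hpos : 0 < E / D * (2 : ℝ) ^ (-s₀ * (n : ℝ) ^ 2) := by positivity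
  have pair_sub {X : Set ℕ} (h₁ : a₁ ∈ X) (h₂ : a₂ ∈ X) :
      (({a₁, a₂} : Finset ℕ) : Set ℕ) ⊆ X := by
    simp [Set.insert_subset_iff, h₁, h₂]
  refine csSup_le ⟨s₀, hs₀, _, pair_sub h₁A h₂A, hpair, hs₀eq⟩ ?_
  rintro s ⟨-, F, hFA, -, hF⟩
  rcases le_total s s₀ with hs | hs
  · linarith [le_phiSq hB (pair_sub h₁B h₂B) hpair hs₀ hs₀eq]
  have hs1 : s ≤ 1 := le_one_of_moranSumSq_eq_one (fun a ha => hA a (hFA ha)) hF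
  set G : Finset ℕ := F.filter (· ≤ n) ∪ {a₁, a₂}
  have hpG : ({a₁, a₂} : Finset ℕ) ⊆ G := Finset.subset_union_right
  have hGB : (G : Set ℕ) ⊆ B := by
    intro a ha
    rcases Finset.mem_union.1 ha with h | h
    · obtain ⟨h1, h2⟩ := Finset.mem_filter.1 h
      exact hAB a (hA a (hFA h1)) h2 (hFA h1)
    · exact pair_sub h₁B h₂B h
  obtain ⟨t, ⟨ht0, -⟩, ht⟩ : ∃ t ∈ Set.Icc s₀ 1, moranSumSq G t = 1 :=
    intermediate_value_Icc' (hs.trans hs1) (continuous_moranSumSq G).continuousOn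
      ⟨moranSumSq_one_le fun a ha => hB a (hGB ha), hs₀eq ▸ moranSumSq_mono hpG s₀⟩
  have htB : t ≤ phiSq B :=
    le_phiSq hB hGB (hpair.trans (Finset.card_le_card hpG)) (hs₀.trans_le ht0) ht
  rcases le_total s t with hst | hts
  · linarith
  have hsplit : moranSumSq F s =
      moranSumSq (F.filter (· ≤ n)) s + moranSumSq (F.filter (¬ · ≤ n)) s :=
    (Finset.sum_filter_add_sum_filter_not F _ _).symm
  have htail : moranSumSq (F.filter (¬ · ≤ n)) s ≤ (2 : ℝ) ^ (-s₀ * (n : ℝ) ^ 2) * E :=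
    (moranSumSq_anti _ hs).trans
      (moranSumSq_tail_le (fun a ha => not_le.1 (Finset.mem_filter.1 ha).2) hs₀)
  have hhead : moranSumSq (F.filter (· ≤ n)) s ≤ moranSumSq G s :=
    moranSumSq_mono Finset.subset_union_left s
  have hdec := le_moranSumSq_sub (hpG (Finset.mem_insert_self a₁ _)) hts
  have hDs : D ≤ (a₁ : ℝ) ^ 2 * Real.log 2 * (2 : ℝ) ^ (-((a₁ : ℝ) ^ 2) * s) := by
    have := moran_term_anti a₁ hs1
    rw [mul_one] at this
    exact mul_le_mul_of_nonneg_left this (by positivity)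
  have hmain : (s - t) * D ≤ (2 : ℝ) ^ (-s₀ * (n : ℝ) ^ 2) * E := by
    linarith [mul_le_mul_of_nonneg_left hDs (sub_nonneg.2 hts)]
  have : s - t ≤ E / D * (2 : ℝ) ^ (-s₀ * (n : ℝ) ^ 2) := by
    rw [div_mul_eq_mul_div, le_div_iff₀ hD]
    linarith
  linarith

/-- Fix `a₁ < a₂` in `ℕ = {1,2,...}` and set `s₀ := s({a₁, a₂})`.  There
is a constant `C > 0`, depending only on `a₁, a₂`, such that for every integer `n ≥ a₂`
and all `A, B ⊆ ℕ` containing `{a₁, a₂}` with `A ∩ {1, ..., n} = B ∩ {1, ..., n}`,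
one has `|Φ(A) − Φ(B)| ≤ C·2^{-s₀·n²}`. -/
theorem phi_locally_constant_estimate
    (a₁ a₂ : ℕ) (ha₁ : 1 ≤ a₁) (ha : a₁ < a₂)
    (s₀ : ℝ) (hs₀ : 0 < s₀)
    (hs₀eq : moranSumSq ({a₁, a₂} : Finset ℕ) s₀ = 1) :
    ∃ C : ℝ, 0 < C ∧
      ∀ n : ℕ, a₂ ≤ n →
        ∀ A B : Set ℕ, (∀ a ∈ A, 1 ≤ a) → (∀ a ∈ B, 1 ≤ a) →
          a₁ ∈ A → a₂ ∈ A → a₁ ∈ B → a₂ ∈ B →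
          (∀ k : ℕ, 1 ≤ k → k ≤ n → (k ∈ A ↔ k ∈ B)) →
          |phiSq A - phiSq B| ≤ C * (2 : ℝ) ^ (-s₀ * (n : ℝ) ^ 2) := by
  have hq1 : (2 : ℝ) ^ (-s₀) < 1 :=
    Real.rpow_lt_one_of_one_lt_of_neg (by norm_num) (by linarith)
  have ha₁' : (0 : ℝ) < a₁ := by exact_mod_cast ha₁
  have hlog := Real.log_pos one_lt_two
  refine ⟨(2 : ℝ) ^ (-s₀) * (1 - (2 : ℝ) ^ (-s₀))⁻¹ /
      ((a₁ : ℝ) ^ 2 * Real.log 2 * (2 : ℝ) ^ (-((a₁ : ℝ) ^ 2))),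
    div_pos (mul_pos (by positivity) (inv_pos.2 (by linarith))) (by positivity), ?_⟩
  intro n _ A B hA hB h₁A h₂A h₁B h₂B hAB
  rw [abs_sub_le_iff]
  constructor
  · exact sub_le_iff_le_add'.2 (phiSq_le_add ha₁ ha hs₀ hs₀eq hA hB h₁A h₂A h₁B h₂B
      fun k h1 h2 => (hAB k h1 h2).1)
  · exact sub_le_iff_le_add'.2 (phiSq_le_add ha₁ ha hs₀ hs₀eq hB hA h₁B h₂B h₁A h₂A
      fun k h1 h2 => (hAB k h1 h2).2)
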